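/- arXiv:2405.12684 — 2 statements merged into one kernel-verified Lean document; each statement's English description precedes it below -/
import Mathlib

section
/- Under the bounded support assumption, let 0 < T₀ < (log 2)/2 and T₀ ≤ T < ∞ and R > 0. Then for every t ∈ [T₀, T] and every y ∈ ℝ^d with ‖y‖ ≤ R, the time derivative of the score satisfies ‖ ∂_t ∇_y log p_t(y) ‖ ≤ 2 √d (R + 1)/T₀² + 2 d^{3/2} (R + 1)/T₀³. -/
open MeasureTheory Real

/-- The density `p_t(y) = ∫ (2π σ_t²)^{-d/2} exp(−‖y − μ_t y₀‖²/(2σ_t²)) p₀(dy₀)` of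
`Y_t = e^{-t} Y₀ + √(1 − e^{-2t}) Z` where `Y₀ ~ p₀`. -/
noncomputable def pt (d : ℕ) (p₀ : Measure (EuclideanSpace ℝ (Fin d))) (t : ℝ)
    (y : EuclideanSpace ℝ (Fin d)) : ℝ :=
  ∫ y₀, (2 * π * (1 - Real.exp (-2 * t))) ^ (-(d : ℝ) / 2) *
      Real.exp (-‖y - Real.exp (-t) • y₀‖ ^ 2 / (2 * (1 - Real.exp (-2 * t)))) ∂p₀

/-- The score `∇_y log p_t(y)`. -/
noncomputable def score (d : ℕ) (p₀ : Measure (EuclideanSpace ℝ (Fin d))) (t : ℝ)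
    (y : EuclideanSpace ℝ (Fin d)) : EuclideanSpace ℝ (Fin d) :=
  gradient (fun z => Real.log (pt d p₀ t z)) y

open Filter Topology in
/-- Differentiation under the integral sign, for a measure carried by a compact set and an
integrand with jointly continuous derivative. -/
theorem hasFDerivAt_integral_of_isCompact
    {X Ω G : Type*} [NormedAddCommGroup X] [NormedSpace ℝ X] [ProperSpace X]
    [TopologicalSpace Ω] [MeasurableSpace Ω] [OpensMeasurableSpace Ω]
    [SecondCountableTopology Ω] [TopologicalSpace.PseudoMetrizableSpace Ω]
    [NormedAddCommGroup G] [NormedSpace ℝ G]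
    {μ : Measure Ω} [IsFiniteMeasure μ] {S : Set Ω} (hS : IsCompact S) (hμ : ∀ᵐ ω ∂μ, ω ∈ S)
    {F : X → Ω → G} {F' : X → Ω → X →L[ℝ] G}
    (hF : ∀ x, Continuous (F x)) (hF' : Continuous (fun q : X × Ω => F' q.1 q.2))
    (hder : ∀ x ω, HasFDerivAt (fun x => F x ω) (F' x ω) x) (x₀ : X) :
    Integrable (F' x₀) μ ∧
      HasFDerivAt (fun x => ∫ ω, F x ω ∂μ) (∫ ω, F' x₀ ω ∂μ) x₀ := by
  have hF'x : Continuous (F' x₀) := hF'.comp (Continuous.prodMk_right x₀)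
  obtain ⟨C, hC⟩ := hS.exists_bound_of_continuousOn (hF x₀).continuousOn
  obtain ⟨C', hC'⟩ := ((isCompact_closedBall x₀ 1).prod hS).exists_bound_of_continuousOn
    hF'.continuousOn
  refine ⟨Integrable.of_bound hF'x.aestronglyMeasurable C'
    (hμ.mono fun ω hω => hC' (x₀, ω) ⟨Metric.mem_closedBall_self zero_le_one, hω⟩), ?_⟩
  exact hasFDerivAt_integral_of_dominated_of_fderiv_le (bound := fun _ => C')
    (Metric.closedBall_mem_nhds x₀ zero_lt_one)
    (Eventually.of_forall fun x => (hF x).aestronglyMeasurable)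
    (Integrable.of_bound (hF x₀).aestronglyMeasurable C (hμ.mono hC))
    hF'x.aestronglyMeasurable
    (hμ.mono fun ω hω x hx => hC' (x, ω) ⟨hx, hω⟩)
    (integrable_const _) (Eventually.of_forall fun ω x _ => hder x ω)

section Gibbs

variable {E : Type*} [NormedAddCommGroup E] [InnerProductSpace ℝ E]

/-- The Gibbs weight `exp (⟪u, x⟫ - b ‖x‖²)` with natural parameter `q = (u, b)`. -/
noncomputable def gibbsWeight (q : E × ℝ) (x : E) : ℝ :=
  Real.exp (inner ℝ q.1 x - q.2 * ‖x‖ ^ 2)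

/-- The exponent of `gibbsWeight` at `x`, as a continuous linear form in the parameter. -/
noncomputable def gibbsForm (x : E) : E × ℝ →L[ℝ] ℝ :=
  (innerSL ℝ x).comp (ContinuousLinearMap.fst ℝ E ℝ) -
    (‖x‖ ^ 2) • ContinuousLinearMap.snd ℝ E ℝ

theorem gibbsForm_apply (x : E) (q : E × ℝ) :
    gibbsForm x q = inner ℝ q.1 x - q.2 * ‖x‖ ^ 2 := by
  simp [gibbsForm, real_inner_comm, mul_comm]

theorem continuous_gibbsForm : Continuous (gibbsForm : E → E × ℝ →L[ℝ] ℝ) := by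
  unfold gibbsForm
  fun_prop

theorem hasFDerivAt_gibbsWeight (q : E × ℝ) (x : E) :
    HasFDerivAt (fun q => gibbsWeight q x) (gibbsWeight q x • gibbsForm x) q := by
  have h := (gibbsForm x).hasFDerivAt (x := q)
  simpa only [gibbsWeight, gibbsForm_apply] using h.exp

theorem continuous_gibbsWeight : Continuous (fun r : (E × ℝ) × E => gibbsWeight r.1 r.2) := by
  unfold gibbsWeight
  fun_prop

theorem gibbsWeight_pos (q : E × ℝ) (x : E) : 0 < gibbsWeight q x := Real.exp_pos _

variable [FiniteDimensional ℝ E] [MeasurableSpace E] [BorelSpace E]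
  {G : Type*} [NormedAddCommGroup G] [NormedSpace ℝ G]

theorem integrable_of_continuous_of_isCompact {H : Type*} [NormedAddCommGroup H]
    {p : Measure E} [IsFiniteMeasure p] {S : Set E}
    (hS : IsCompact S) (hp : ∀ᵐ x ∂p, x ∈ S) {f : E → H} (hf : Continuous f) :
    Integrable f p := by
  obtain ⟨C, hC⟩ := hS.exists_bound_of_continuousOn hf.continuousOn
  exact Integrable.of_bound hf.aestronglyMeasurable C (hp.mono hC)

theorem hasFDerivAt_integral_gibbsWeight {p : Measure E} [IsFiniteMeasure p] {S : Set E}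
    (hS : IsCompact S) (hp : ∀ᵐ x ∂p, x ∈ S) {g : E → G} (hg : Continuous g) (q : E × ℝ) :
    ∃ L : E × ℝ →L[ℝ] G, (∀ r, L r = ∫ x, (gibbsWeight q x * gibbsForm x r) • g x ∂p) ∧
      HasFDerivAt (fun q => ∫ x, gibbsWeight q x • g x ∂p) L q := by
  have : ProperSpace E := FiniteDimensional.proper ℝ E
  have hw := continuous_gibbsWeight (E := E)
  have hl := continuous_gibbsForm (E := E)
  obtain ⟨hi, hd⟩ := hasFDerivAt_integral_of_isCompact hS hp
    (F := fun q x => gibbsWeight q x • g x)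
    (F' := fun q x => (gibbsWeight q x • gibbsForm x).smulRight (g x))
    (fun q => (hw.comp (Continuous.prodMk_right q)).smul hg)
    (by
      have h1 : Continuous fun r : (E × ℝ) × E => gibbsWeight r.1 r.2 • gibbsForm r.2 :=
        hw.smul (hl.comp continuous_snd)
      have h2 : Continuous fun r : (E × ℝ) × E => g r.2 := hg.comp continuous_snd
      exact (ContinuousLinearMap.smulRightL ℝ (E × ℝ) G).continuous₂.comp (h1.prodMk h2))
    (fun q x => (hasFDerivAt_gibbsWeight q x).smul_const (g x)) q
  refine ⟨_, fun r => ?_, hd⟩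
  rw [ContinuousLinearMap.integral_apply hi]
  rfl

/-- The Gibbs partition function. -/
noncomputable def gibbsPartition (p : Measure E) (q : E × ℝ) : ℝ := ∫ x, gibbsWeight q x ∂p

/-- The mean of the Gibbs reweighting of `p`. -/
noncomputable def gibbsMean (p : Measure E) (q : E × ℝ) : E :=
  (gibbsPartition p q)⁻¹ • ∫ x, gibbsWeight q x • x ∂p

theorem integrable_gibbsWeight_smul {p : Measure E} [IsFiniteMeasure p] {S : Set E}
    (hS : IsCompact S) (hp : ∀ᵐ x ∂p, x ∈ S) {f : E → G} (hf : Continuous f) (q : E × ℝ) :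
    Integrable (fun x => gibbsWeight q x • f x) p :=
  integrable_of_continuous_of_isCompact hS hp
    ((continuous_gibbsWeight.comp (Continuous.prodMk_right q)).smul hf)

theorem integrable_gibbsWeight {p : Measure E} [IsFiniteMeasure p] {S : Set E}
    (hS : IsCompact S) (hp : ∀ᵐ x ∂p, x ∈ S) (q : E × ℝ) : Integrable (gibbsWeight q) p := by
  simpa using integrable_gibbsWeight_smul hS hp (f := fun _ => (1 : ℝ)) continuous_const q

theorem gibbsPartition_pos {p : Measure E} [IsProbabilityMeasure p] {S : Set E}
    (hS : IsCompact S) (hp : ∀ᵐ x ∂p, x ∈ S) (q : E × ℝ) : 0 < gibbsPartition p q := by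
  refine (integral_pos_iff_support_of_nonneg (fun x => (gibbsWeight_pos q x).le)
    (integrable_gibbsWeight hS hp q)).2 ?_
  have : Function.support (gibbsWeight q) = (Set.univ : Set E) :=
    Set.eq_univ_of_forall fun x => (gibbsWeight_pos q x).ne'
  simp [this]

/-- A Gibbs average of a function bounded by `C` on the support is bounded by `C`. -/
theorem norm_gibbsAverage_le {p : Measure E} [IsProbabilityMeasure p] {S : Set E}
    (hS : IsCompact S) (hp : ∀ᵐ x ∂p, x ∈ S) {f : E → G} {C : ℝ} (hf : ∀ x ∈ S, ‖f x‖ ≤ C)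
    (q : E × ℝ) : ‖(gibbsPartition p q)⁻¹ • ∫ x, gibbsWeight q x • f x ∂p‖ ≤ C := by
  have hZ := gibbsPartition_pos hS hp q
  have h : ‖∫ x, gibbsWeight q x • f x ∂p‖ ≤ ∫ x, gibbsWeight q x * C ∂p := by
    refine norm_integral_le_of_norm_le ((integrable_gibbsWeight hS hp q).mul_const C)
      (hp.mono fun x hx => ?_)
    rw [norm_smul, Real.norm_of_nonneg (gibbsWeight_pos q x).le]
    exact mul_le_mul_of_nonneg_left (hf x hx) (gibbsWeight_pos q x).le
  rw [integral_mul_const] at h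
  rw [norm_smul, norm_inv, Real.norm_of_nonneg hZ.le, inv_mul_le_iff₀ hZ]
  exact h

theorem norm_sub_gibbsMean_le {p : Measure E} [IsProbabilityMeasure p] {S : Set E}
    (hS : IsCompact S) (hp : ∀ᵐ x ∂p, x ∈ S) {K : ℝ} (hK : ∀ x ∈ S, ∀ y ∈ S, ‖x - y‖ ≤ K)
    (q : E × ℝ) {x : E} (hx : x ∈ S) : ‖x - gibbsMean p q‖ ≤ K := by
  have hZ := gibbsPartition_pos hS hp q
  have h := norm_gibbsAverage_le hS hp (hK x hx) q
  simp_rw [smul_sub] at h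
  rw [integral_sub (integrable_gibbsWeight_smul hS hp continuous_const q)
    (integrable_gibbsWeight_smul hS hp continuous_id' q), integral_smul_const, smul_sub,
    smul_smul] at h
  change ‖((gibbsPartition p q)⁻¹ * gibbsPartition p q) • x - gibbsMean p q‖ ≤ K at h
  rwa [inv_mul_cancel₀ hZ.ne', one_smul] at h

theorem hasFDerivAt_gibbsPartition {p : Measure E} [IsProbabilityMeasure p] {S : Set E}
    (hS : IsCompact S) (hp : ∀ᵐ x ∂p, x ∈ S) (q : E × ℝ) :
    ∃ L : E × ℝ →L[ℝ] ℝ, (∀ r, L r = ∫ x, gibbsWeight q x * gibbsForm x r ∂p) ∧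
      HasFDerivAt (gibbsPartition p) L q := by
  obtain ⟨L, hL, hd⟩ := hasFDerivAt_integral_gibbsWeight hS hp (g := fun _ => (1 : ℝ))
    continuous_const q
  refine ⟨L, fun r => ?_, ?_⟩
  · simpa using hL r
  · simp only [smul_eq_mul, mul_one] at hd
    exact hd

/-- The gradient of the log-partition function in the linear parameter is the Gibbs mean. -/
theorem hasGradientAt_log_gibbsPartition {p : Measure E} [IsProbabilityMeasure p] {S : Set E}
    (hS : IsCompact S) (hp : ∀ᵐ x ∂p, x ∈ S) (a b : ℝ) (z : E) :
    HasGradientAt (fun z => Real.log (gibbsPartition p (a • z, b)))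
      (a • gibbsMean p (a • z, b)) z := by
  obtain ⟨L, hL, hd⟩ := hasFDerivAt_gibbsPartition hS hp (a • z, b)
  have hZ := gibbsPartition_pos hS hp (a • z, b)
  have hγ : HasFDerivAt (fun z : E => (a • z, b))
      ((a • ContinuousLinearMap.id ℝ E).prod 0) z :=
    ((hasFDerivAt_id z).const_smul a).prodMk (hasFDerivAt_const b z)
  rw [hasGradientAt_iff_hasFDerivAt]
  have hlog : HasFDerivAt (fun z => Real.log (gibbsPartition p (a • z, b))) _ z :=
    (HasFDerivAt.comp (f := fun z : E => (a • z, b)) z hd hγ).log hZ.ne'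
  refine hlog.congr_fderiv (ContinuousLinearMap.ext fun v => ?_)
  have hi := integrable_gibbsWeight_smul hS hp continuous_id' (a • z, b)
  have h1 : ∫ x, gibbsWeight (a • z, b) x * gibbsForm x (a • v, 0) ∂p =
      a * inner ℝ v (∫ x, gibbsWeight (a • z, b) x • x ∂p) := by
    rw [← integral_inner hi, ← integral_const_mul]
    congr 1 with x
    simp only [gibbsForm_apply, real_inner_smul_left, real_inner_smul_right]
    ring
  simp [hL, h1, gibbsMean, real_inner_comm]
  ring

/-- Differentiating the Gibbs mean along a curve of parameters: the derivative is a covariance. -/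
theorem exists_hasDerivAt_gibbsMean {p : Measure E} [IsProbabilityMeasure p] {S : Set E}
    (hS : IsCompact S) (hp : ∀ᵐ x ∂p, x ∈ S) {K M : ℝ} (hK : ∀ x ∈ S, ∀ y ∈ S, ‖x - y‖ ≤ K)
    {γ : ℝ → E × ℝ} {γ' : E × ℝ} {t : ℝ} (hγ : HasDerivAt γ γ' t)
    (hM : ∀ x ∈ S, |gibbsForm x γ'| ≤ M) :
    ∃ m', HasDerivAt (fun s => gibbsMean p (γ s)) m' t ∧ ‖m'‖ ≤ M * K := by
  obtain ⟨L, hL, hd⟩ := hasFDerivAt_gibbsPartition hS hp (γ t)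
  obtain ⟨L', hL', hd'⟩ := hasFDerivAt_integral_gibbsWeight hS hp (g := fun x => x)
    continuous_id' (γ t)
  have hZ := gibbsPartition_pos hS hp (γ t)
  have hl : Continuous fun x : E => gibbsForm x γ' :=
    continuous_gibbsForm.clm_apply continuous_const
  refine ⟨_, ((hd.comp_hasDerivAt t hγ).inv hZ.ne').smul (hd'.comp_hasDerivAt t hγ), ?_⟩
  have hbound : ∀ x ∈ S, ‖gibbsForm x γ' • (x - gibbsMean p (γ t))‖ ≤ M * K := by
    intro x hx
    rw [norm_smul]
    exact mul_le_mul (hM x hx) (norm_sub_gibbsMean_le hS hp hK _ hx) (norm_nonneg _)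
      ((abs_nonneg _).trans (hM x hx))
  convert norm_gibbsAverage_le hS hp hbound (γ t) using 2
  have hcov : ∫ x, gibbsWeight (γ t) x • gibbsForm x γ' • (x - gibbsMean p (γ t)) ∂p =
      L' γ' - L γ' • gibbsMean p (γ t) := by
    rw [hL, hL', ← integral_smul_const, ← integral_sub]
    · congr 1 with x
      rw [smul_sub, smul_sub, smul_smul, smul_smul]
    · simp only [mul_smul]
      exact integrable_gibbsWeight_smul hS hp (hl.smul continuous_id') (γ t)
    · simp only [mul_smul]
      exact integrable_gibbsWeight_smul hS hp
        (hl.smul (continuous_const (y := gibbsMean p (γ t)))) (γ t)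
  rw [hcov, gibbsMean, smul_sub, smul_smul, smul_smul]
  simp only [Function.comp_apply, sub_eq_add_neg, ← neg_smul]
  congr 2
  field_simp

end Gibbs

theorem one_sub_exp_neg_two_mul_pos {s : ℝ} (hs : 0 < s) : 0 < 1 - Real.exp (-2 * s) := by
  have : Real.exp (-2 * s) < 1 := by
    rw [← Real.exp_zero]
    exact Real.exp_lt_exp.2 (by linarith)
  linarith

theorem le_one_sub_exp_neg_two_mul {T₀ t : ℝ} (hT₀ : 0 < T₀) (hT₀' : T₀ < Real.log 2 / 2)
    (ht : T₀ ≤ t) : T₀ ≤ 1 - Real.exp (-2 * t) := by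
  have hlog := Real.log_two_lt_d9
  have h1 : Real.exp (-2 * t) ≤ Real.exp (-(2 * T₀)) := Real.exp_le_exp.2 (by linarith)
  have h2 := Real.quadratic_le_exp_of_nonneg (x := 2 * T₀) (by linarith)
  have h3 : Real.exp (-(2 * T₀)) ≤ 1 - T₀ := by
    rw [Real.exp_neg, inv_le_iff_one_le_mul₀ (Real.exp_pos _)]
    have hlt : T₀ < 1 / 2 := by linarith
    have h4 : 1 ≤ (1 - T₀) * (1 + 2 * T₀ + (2 * T₀) ^ 2 / 2) := by
      nlinarith [mul_pos hT₀ hT₀, mul_pos (mul_pos hT₀ hT₀) hT₀]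
    exact h4.trans (mul_le_mul_of_nonneg_left h2 (by linarith))
  linarith

theorem exp_neg_two_mul (s : ℝ) : Real.exp (-2 * s) = Real.exp (-s) ^ 2 := by
  rw [← Real.exp_nat_mul]
  congr 1
  push_cast
  ring

theorem hasDerivAt_inv_one_sub_exp {t : ℝ} (ht : 0 < t) :
    HasDerivAt (fun s => (1 - Real.exp (-2 * s))⁻¹)
      (-(2 * Real.exp (-t) ^ 2 / (1 - Real.exp (-2 * t)) ^ 2)) t := by
  have h : HasDerivAt (fun s => 1 - Real.exp (-2 * s)) (2 * Real.exp (-2 * t)) t :=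
    ((((hasDerivAt_id t).const_mul (-2)).exp).const_sub 1).congr_deriv (by simp; ring)
  refine (h.inv (one_sub_exp_neg_two_mul_pos ht).ne').congr_deriv ?_
  rw [← exp_neg_two_mul]
  ring

theorem hasDerivAt_exp_neg_div {t : ℝ} (ht : 0 < t) :
    HasDerivAt (fun s => Real.exp (-s) / (1 - Real.exp (-2 * s)))
      (-(Real.exp (-t) * (1 + Real.exp (-t) ^ 2) / (1 - Real.exp (-2 * t)) ^ 2)) t := by
  have hv := (one_sub_exp_neg_two_mul_pos ht).ne'
  refine ((hasDerivAt_neg t).exp.mul (hasDerivAt_inv_one_sub_exp ht)).congr_deriv ?_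
  have hw := exp_neg_two_mul t
  generalize Real.exp (-2 * t) = w at hv hw ⊢
  field_simp
  rw [hw]
  ring

theorem hasDerivAt_exp_neg_sq_div {t : ℝ} (ht : 0 < t) :
    HasDerivAt (fun s => Real.exp (-s) ^ 2 / (2 * (1 - Real.exp (-2 * s))))
      (-(Real.exp (-t) ^ 2 / (1 - Real.exp (-2 * t)) ^ 2)) t := by
  have hv := (one_sub_exp_neg_two_mul_pos ht).ne'
  have hfun : (fun s => Real.exp (-s) ^ 2 / (2 * (1 - Real.exp (-2 * s)))) =
      fun s => Real.exp (-s) / 2 * (Real.exp (-s) / (1 - Real.exp (-2 * s))) := by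
    ext s
    field_simp
  rw [hfun]
  refine (((hasDerivAt_neg t).exp.div_const 2).mul (hasDerivAt_exp_neg_div ht)).congr_deriv ?_
  have hw := exp_neg_two_mul t
  generalize Real.exp (-2 * t) = w at hv hw ⊢
  field_simp
  rw [hw]
  ring

section Score

variable {d : ℕ}

/-- The unit cube `[0,1]^d` in Euclidean space. -/
def unitCube (d : ℕ) : Set (EuclideanSpace ℝ (Fin d)) := {x | ∀ i, x i ∈ Set.Icc (0 : ℝ) 1}

theorem norm_le_sqrt_of_abs_le_one {x : EuclideanSpace ℝ (Fin d)} (hx : ∀ i, |x i| ≤ 1) :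
    ‖x‖ ≤ √d := by
  rw [EuclideanSpace.norm_eq]
  refine Real.sqrt_le_sqrt ?_
  calc ∑ i, ‖x i‖ ^ 2 ≤ ∑ _i : Fin d, (1 : ℝ) :=
        Finset.sum_le_sum fun i _ => pow_le_one₀ (norm_nonneg _) (hx i)
    _ = d := by simp

theorem norm_le_of_mem_unitCube {x : EuclideanSpace ℝ (Fin d)} (hx : x ∈ unitCube d) :
    ‖x‖ ≤ √d :=
  norm_le_sqrt_of_abs_le_one fun i => abs_le.2 ⟨by linarith [(hx i).1], (hx i).2⟩

theorem norm_sub_le_of_mem_unitCube {x y : EuclideanSpace ℝ (Fin d)} (hx : x ∈ unitCube d)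
    (hy : y ∈ unitCube d) : ‖x - y‖ ≤ √d := by
  refine norm_le_sqrt_of_abs_le_one fun i => ?_
  have hxi := hx i
  have hyi := hy i
  rw [PiLp.sub_apply, abs_le]
  constructor <;> linarith [hxi.1, hxi.2, hyi.1, hyi.2]

theorem isCompact_unitCube : IsCompact (unitCube d) := by
  refine Metric.isCompact_of_isClosed_isBounded ?_ ?_
  · have : unitCube d = ⋂ i, {x | x i ∈ Set.Icc (0 : ℝ) 1} := by
      ext x
      simp [unitCube]
    rw [this]
    exact isClosed_iInter fun i => isClosed_Icc.preimage (by fun_prop)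
  · exact Metric.isBounded_closedBall.subset fun x hx =>
      mem_closedBall_zero_iff.2 (norm_le_of_mem_unitCube hx)

variable {p₀ : Measure (EuclideanSpace ℝ (Fin d))}

theorem pt_eq {s : ℝ} (hs : 0 < s) (y : EuclideanSpace ℝ (Fin d)) :
    pt d p₀ s y = (2 * π * (1 - Real.exp (-2 * s))) ^ (-(d : ℝ) / 2) *
      Real.exp (-(1 - Real.exp (-2 * s))⁻¹ / 2 * ‖y‖ ^ 2) *
      gibbsPartition p₀ ((Real.exp (-s) / (1 - Real.exp (-2 * s))) • y,
        Real.exp (-s) ^ 2 / (2 * (1 - Real.exp (-2 * s)))) := by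
  have hv := (one_sub_exp_neg_two_mul_pos hs).ne'
  rw [pt, gibbsPartition, ← integral_const_mul]
  congr 1 with x
  rw [gibbsWeight, mul_assoc _ (Real.exp _) (Real.exp _), ← Real.exp_add]
  congr 2
  rw [norm_sub_sq_real, real_inner_smul_right, norm_smul, real_inner_smul_left,
    Real.norm_of_nonneg (Real.exp_pos _).le]
  field_simp
  ring

theorem score_eq [IsProbabilityMeasure p₀] (hp : ∀ᵐ x ∂p₀, x ∈ unitCube d) {s : ℝ} (hs : 0 < s)
    (y : EuclideanSpace ℝ (Fin d)) :
    score d p₀ s y = (Real.exp (-s) / (1 - Real.exp (-2 * s))) •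
        gibbsMean p₀ ((Real.exp (-s) / (1 - Real.exp (-2 * s))) • y,
          Real.exp (-s) ^ 2 / (2 * (1 - Real.exp (-2 * s)))) -
      (1 - Real.exp (-2 * s))⁻¹ • y := by
  have hv := one_sub_exp_neg_two_mul_pos hs
  set v := 1 - Real.exp (-2 * s)
  have hc : (2 * π * v) ^ (-(d : ℝ) / 2) ≠ 0 := (Real.rpow_pos_of_pos (by positivity) _).ne'
  have hlog : (fun z => Real.log (pt d p₀ s z)) = fun z =>
      Real.log ((2 * π * v) ^ (-(d : ℝ) / 2)) + -v⁻¹ / 2 * ‖z‖ ^ 2 +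
        Real.log (gibbsPartition p₀ ((Real.exp (-s) / v) • z, Real.exp (-s) ^ 2 / (2 * v))) := by
    ext z
    have hZ := (gibbsPartition_pos isCompact_unitCube hp
      ((Real.exp (-s) / v) • z, Real.exp (-s) ^ 2 / (2 * v))).ne'
    rw [pt_eq hs, Real.log_mul (mul_ne_zero hc (Real.exp_pos _).ne') hZ,
      Real.log_mul hc (Real.exp_pos _).ne', Real.log_exp]
  rw [score, hlog]
  refine HasGradientAt.gradient ?_
  have hG := hasGradientAt_log_gibbsPartition isCompact_unitCube hp (Real.exp (-s) / v)
    (Real.exp (-s) ^ 2 / (2 * v)) y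
  rw [hasGradientAt_iff_hasFDerivAt] at hG ⊢
  have hq := ((hasStrictFDerivAt_norm_sq y).hasFDerivAt.const_mul (-v⁻¹ / 2)).const_add
    (Real.log ((2 * π * v) ^ (-(d : ℝ) / 2)))
  refine (hq.add hG).congr_fderiv (ContinuousLinearMap.ext fun w => ?_)
  simp
  ring

end Score

/-- Under the bounded support assumption, for `0 < T₀ < (log 2)/2`, `T₀ ≤ T < ∞` and
`R > 0`, for every `t ∈ [T₀, T]` and every `y` with `‖y‖ ≤ R`,
`‖∂_t ∇_y log p_t(y)‖ ≤ 2√d (R+1)/T₀² + 2 d^{3/2} (R+1)/T₀³`. -/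
theorem score_time_deriv_bound (d : ℕ) (hd : 1 ≤ d)
    (p₀ : Measure (EuclideanSpace ℝ (Fin d))) [IsProbabilityMeasure p₀]
    (hsupp : ∀ᵐ y₀ ∂p₀, ∀ i, y₀ i ∈ Set.Icc (0 : ℝ) 1)
    (T₀ T : ℝ) (hT₀ : 0 < T₀) (hT₀' : T₀ < Real.log 2 / 2) (hT : T₀ ≤ T)
    (R : ℝ) (hR : 0 < R) :
    ∀ t ∈ Set.Icc T₀ T, ∀ y : EuclideanSpace ℝ (Fin d), ‖y‖ ≤ R →
      ‖deriv (fun s => score d p₀ s y) t‖ ≤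
        2 * Real.sqrt d * (R + 1) / T₀ ^ 2 + 2 * (d : ℝ) ^ ((3 : ℝ) / 2) * (R + 1) / T₀ ^ 3 := by
  rintro t ⟨htT₀, -⟩ y hy
  have ht : 0 < t := hT₀.trans_le htT₀
  have hp : ∀ᵐ x ∂p₀, x ∈ unitCube d := hsupp
  have hμ0 := Real.exp_pos (-t)
  have hμ1 : Real.exp (-t) ≤ 1 := Real.exp_le_one_iff.2 (by linarith)
  have hvT := le_one_sub_exp_neg_two_mul hT₀ hT₀' htT₀
  have ha := hasDerivAt_exp_neg_div ht
  have hb := hasDerivAt_exp_neg_sq_div ht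
  have hc := hasDerivAt_inv_one_sub_exp ht
  have hv := one_sub_exp_neg_two_mul_pos ht
  have hμsq : Real.exp (-t) ^ 2 ≤ 1 := pow_le_one₀ hμ0.le hμ1
  have hdiv : ∀ {k n : ℝ}, 0 ≤ n → n ≤ k →
      |-(n / (1 - Real.exp (-2 * t)) ^ 2)| ≤ k / T₀ ^ 2 := by
    intro k n hn hk
    rw [abs_neg, abs_of_nonneg (by positivity)]
    gcongr
    exact hn.trans hk
  have ha' := hdiv (k := 2) (n := Real.exp (-t) * (1 + Real.exp (-t) ^ 2)) (by positivity)
    (by nlinarith)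
  have hb' := hdiv (k := 1) (n := Real.exp (-t) ^ 2) (by positivity) hμsq
  have hc' := hdiv (k := 2) (n := 2 * Real.exp (-t) ^ 2) (by positivity) (by linarith)
  have haT : |Real.exp (-t) / (1 - Real.exp (-2 * t))| ≤ 1 / T₀ := by
    rw [abs_of_nonneg (by positivity)]
    gcongr
  generalize -(Real.exp (-t) * (1 + Real.exp (-t) ^ 2) / (1 - Real.exp (-2 * t)) ^ 2) = a'
    at ha ha'
  generalize -(Real.exp (-t) ^ 2 / (1 - Real.exp (-2 * t)) ^ 2) = b' at hb hb'
  generalize -(2 * Real.exp (-t) ^ 2 / (1 - Real.exp (-2 * t)) ^ 2) = c' at hc hc'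
  have hM : ∀ x ∈ unitCube d,
      |gibbsForm x (a' • y, b')| ≤ 2 / T₀ ^ 2 * R * √d + 1 / T₀ ^ 2 * d := by
    intro x hx
    have hx' := norm_le_of_mem_unitCube hx
    have hx2 : ‖x‖ ^ 2 ≤ d := (Real.le_sqrt (norm_nonneg x) (Nat.cast_nonneg d)).1 hx'
    rw [gibbsForm_apply]
    calc |inner ℝ (a' • y) x - b' * ‖x‖ ^ 2| ≤ |inner ℝ (a' • y) x| + |b' * ‖x‖ ^ 2| := abs_sub _ _
      _ ≤ |a'| * ‖y‖ * ‖x‖ + |b'| * ‖x‖ ^ 2 := by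
        gcongr
        · exact (abs_real_inner_le_norm _ _).trans_eq (by rw [norm_smul, Real.norm_eq_abs])
        · rw [abs_mul, abs_of_nonneg (sq_nonneg ‖x‖)]
      _ ≤ _ := by gcongr
  obtain ⟨m', hm', hm'_le⟩ := exists_hasDerivAt_gibbsMean isCompact_unitCube hp
    (fun x hx y hy => norm_sub_le_of_mem_unitCube hx hy)
    ((ha.smul_const y).prodMk hb) hM
  have hm := norm_gibbsAverage_le isCompact_unitCube hp
    (f := fun x => x) (fun x hx => norm_le_of_mem_unitCube hx)
    ((Real.exp (-t) / (1 - Real.exp (-2 * t))) • y,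
      Real.exp (-t) ^ 2 / (2 * (1 - Real.exp (-2 * t))))
  have hscore := ((ha.smul hm').sub (hc.smul_const y)).congr_of_eventuallyEq
    (f₁ := fun s => score d p₀ s y)
    ((eventually_gt_nhds ht).mono fun s hs => score_eq hp hs y)
  rw [hscore.deriv]
  have hd1 : 1 ≤ √(d : ℝ) := Real.one_le_sqrt.2 (by exact_mod_cast hd)
  have hpow : (d : ℝ) ^ ((3 : ℝ) / 2) = d * √d := by
    rw [show (3 : ℝ) / 2 = 1 + 1 / 2 by norm_num, Real.rpow_add (by positivity), Real.rpow_one,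
      Real.sqrt_eq_rpow]
  have hdd : √(d : ℝ) * √d = d := Real.mul_self_sqrt (Nat.cast_nonneg d)
  refine (norm_sub_le _ _).trans ((add_le_add_left (norm_add_le _ _) _).trans ?_)
  rw [norm_smul, norm_smul, norm_smul, Real.norm_eq_abs, Real.norm_eq_abs, Real.norm_eq_abs, hpow]
  calc _ ≤ 1 / T₀ * ((2 / T₀ ^ 2 * R * √d + 1 / T₀ ^ 2 * d) * √d) + 2 / T₀ ^ 2 * √d +
        2 / T₀ ^ 2 * R := by
        gcongr
        exact hm
    _ = 2 * (√d + R) / T₀ ^ 2 + (2 * R * (√d * √d) + d * √d) / T₀ ^ 3 := by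
        field_simp
        ring
    _ ≤ 2 * √d * (R + 1) / T₀ ^ 2 + 2 * (d * √d) * (R + 1) / T₀ ^ 3 := by
        rw [hdd]
        have hd0 : (0 : ℝ) ≤ d := Nat.cast_nonneg d
        have h₁ : √(d : ℝ) + R ≤ √d * (R + 1) := by nlinarith
        have h₂ : 2 * R * d + d * √d ≤ 2 * (d * √d) * (R + 1) := by
          nlinarith [mul_nonneg (mul_nonneg hd0 hR.le) (sub_nonneg.2 hd1),
            mul_nonneg hd0 (Real.sqrt_nonneg d)]
        rw [mul_assoc 2 (√(d : ℝ))]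
        gcongr
end

section
/- Let Z ~ N(0, I_d) be a standard Gaussian vector on ℝ^d. Then for every r ≥ 0, the truncated second moment satisfies E[ ‖Z‖² · 1{‖Z‖_∞ > r} ] ≤ √(2d) · √(d(d + 2)) · exp(−r²/4). -/
open MeasureTheory Real

/-- The standard Gaussian measure `N(0, I_d)` on `ℝ^d`. -/
noncomputable def stdGaussian (d : ℕ) : Measure (EuclideanSpace ℝ (Fin d)) :=
  volume.withDensity fun y =>
    ENNReal.ofReal ((2 * π) ^ (-(d : ℝ) / 2) * Real.exp (-‖y‖ ^ 2 / 2))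

/-- The sup norm `‖y‖_∞ = max_i |y_i|` on `ℝ^d`. -/
noncomputable def supNorm {d : ℕ} (y : EuclideanSpace ℝ (Fin d)) : ℝ :=
  ‖(fun i => y i : Fin d → ℝ)‖

lemma integral_stdGaussian (d : ℕ) (f : EuclideanSpace ℝ (Fin d) → ℝ) :
    ∫ z, f z ∂(stdGaussian d) =
      ∫ z, (2 * π) ^ (-(d : ℝ) / 2) * (f z * rexp (-‖z‖ ^ 2 / 2)) := by
  rw [stdGaussian, integral_withDensity_eq_integral_toReal_smul (by fun_prop) (by simp)]
  refine integral_congr_ae (.of_forall fun z => ?_)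
  dsimp only
  rw [ENNReal.toReal_ofReal (by positivity), smul_eq_mul]
  ring

/-- The moment generating function of the standard Gaussian vector. -/
lemma integral_exp_inner_stdGaussian (d : ℕ) (w : EuclideanSpace ℝ (Fin d)) :
    ∫ z, rexp (inner ℝ z w) ∂(stdGaussian d) = rexp (‖w‖ ^ 2 / 2) := by
  have hsq (z : EuclideanSpace ℝ (Fin d)) :
      (2 * π) ^ (-(d : ℝ) / 2) * (rexp (inner ℝ z w) * rexp (-‖z‖ ^ 2 / 2)) =
        (2 * π) ^ (-(d : ℝ) / 2) * rexp (‖w‖ ^ 2 / 2) * rexp (-(1 / 2) * ‖z - w‖ ^ 2) := by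
    rw [mul_assoc, ← Real.exp_add, ← Real.exp_add, norm_sub_sq_real]
    ring_nf
  simp_rw [integral_stdGaussian, hsq]
  rw [integral_const_mul, integral_sub_right_eq_self (fun z => rexp (-(1 / 2) * ‖z‖ ^ 2)),
    GaussianFourier.integral_rexp_neg_mul_sq_norm (by norm_num), finrank_euclideanSpace_fin,
    show π / (1 / 2) = 2 * π by ring, mul_right_comm, ← Real.rpow_add (by positivity)]
  simp [neg_div]

lemma integrable_exp_inner_stdGaussian (d : ℕ) (w : EuclideanSpace ℝ (Fin d)) :
    Integrable (fun z => rexp (inner ℝ z w)) (stdGaussian d) :=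
  .of_integral_ne_zero (by rw [integral_exp_inner_stdGaussian]; positivity)

instance isProbabilityMeasure_stdGaussian (d : ℕ) : IsProbabilityMeasure (stdGaussian d) := by
  have h := integral_exp_inner_stdGaussian d 0
  simp only [inner_zero_right, Real.exp_zero, integral_const, norm_zero] at h
  simp only [smul_eq_mul, mul_one, ne_eq, OfNat.ofNat_ne_zero, not_false_eq_true, zero_pow,
    zero_div, Real.exp_zero] at h
  exact ⟨(ENNReal.toReal_eq_one_iff _).1 h⟩

/-- Integration by parts for the half-line moments of the Gaussian weight. -/
lemma integral_pow_add_two_mul_exp_neg_sq_div_two (k : ℕ) :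
    ∫ y in Set.Ioi (0 : ℝ), y ^ (k + 2) * rexp (-y ^ 2 / 2) =
      (k + 1) * ∫ y in Set.Ioi (0 : ℝ), y ^ k * rexp (-y ^ 2 / 2) := by
  have key (m : ℕ) : ∫ y in Set.Ioi (0 : ℝ), y ^ m * rexp (-y ^ 2 / 2) =
      (1 / 2 : ℝ) ^ (-((m : ℝ) + 1) / 2) * (1 / 2) * Gamma (((m : ℝ) + 1) / 2) := by
    rw [← integral_rpow_mul_exp_neg_mul_rpow (p := 2) (q := m) (b := 1 / 2) (by norm_num)
      (by linarith [(Nat.cast_nonneg m : (0 : ℝ) ≤ m)]) (by norm_num)]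
    refine integral_congr_ae (.of_forall fun y => ?_)
    dsimp only
    rw [Real.rpow_natCast, Real.rpow_two]
    ring_nf
  have hk : (0 : ℝ) < (k + 1) / 2 := by positivity
  rw [key, key]
  push_cast
  rw [show ((k : ℝ) + 2 + 1) / 2 = (k + 1) / 2 + 1 by ring, Real.Gamma_add_one hk.ne',
    show -((k : ℝ) + 2 + 1) / 2 = -(k + 1) / 2 + (-1) by ring,
    Real.rpow_add (by norm_num), Real.rpow_neg_one]
  ring

/-- The fourth moment of the norm of a standard Gaussian vector. -/
lemma integral_norm_pow_four_stdGaussian (d : ℕ) (hd : 1 ≤ d) :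
    ∫ z, ‖z‖ ^ 4 ∂(stdGaussian d) = (d : ℝ) * (d + 2) := by
  obtain ⟨n, rfl⟩ : ∃ n, d = n + 1 := ⟨d - 1, by omega⟩
  have hone : ∫ _, (1 : ℝ) ∂(stdGaussian (n + 1)) = 1 := by simp
  rw [integral_stdGaussian, integral_const_mul] at hone ⊢
  rw [integral_fun_norm_addHaar volume (fun y : ℝ => 1 * rexp (-y ^ 2 / 2))] at hone
  rw [integral_fun_norm_addHaar volume (fun y : ℝ => y ^ 4 * rexp (-y ^ 2 / 2))]
  simp only [finrank_euclideanSpace_fin, Nat.add_sub_cancel, smul_eq_mul, one_mul,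
    nsmul_eq_mul, ← mul_assoc, ← pow_add] at hone ⊢
  rw [show n + 4 = n + 2 + 2 by ring, integral_pow_add_two_mul_exp_neg_sq_div_two,
    integral_pow_add_two_mul_exp_neg_sq_div_two]
  push_cast at hone ⊢
  linear_combination ((n : ℝ) + 1) * (n + 3) * hone

lemma measurableSet_lt_supNorm (d : ℕ) (r : ℝ) :
    MeasurableSet {z : EuclideanSpace ℝ (Fin d) | r < supNorm z} := by
  refine measurableSet_lt measurable_const (Continuous.measurable ?_)
  unfold supNorm
  fun_prop

/-- Chernoff and union bound for the sup norm of a standard Gaussian vector. -/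
lemma measureReal_lt_supNorm_stdGaussian_le (d : ℕ) {r : ℝ} (hr : 0 ≤ r) :
    (stdGaussian d).real {z | r < supNorm z} ≤ 2 * d * rexp (-r ^ 2 / 2) := by
  let e (t : ℝ) (i : Fin d) : EuclideanSpace ℝ (Fin d) := EuclideanSpace.single i t
  let F (z : EuclideanSpace ℝ (Fin d)) : ℝ :=
    ∑ i, rexp (-r ^ 2) * (rexp (inner ℝ z (e r i)) + rexp (inner ℝ z (e (-r) i)))
  have hterm (i : Fin d) : Integrable (fun z : EuclideanSpace ℝ (Fin d) =>
      rexp (-r ^ 2) * (rexp (inner ℝ z (e r i)) + rexp (inner ℝ z (e (-r) i))))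
      (stdGaussian d) :=
    ((integrable_exp_inner_stdGaussian d _).add
      (integrable_exp_inner_stdGaussian d _)).const_mul _
  have hF : Integrable F (stdGaussian d) := integrable_finsetSum _ fun i _ => hterm i
  have hint : ∫ z, F z ∂(stdGaussian d) = 2 * d * rexp (-r ^ 2 / 2) := by
    have hexp : rexp (-r ^ 2) * rexp (r ^ 2 / 2) = rexp (-r ^ 2 / 2) := by
      rw [← Real.exp_add]; ring_nf
    rw [integral_finsetSum _ fun i _ => hterm i]
    simp_rw [integral_const_mul, integral_add (integrable_exp_inner_stdGaussian d _)
      (integrable_exp_inner_stdGaussian d _), integral_exp_inner_stdGaussian]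
    simp only [e, PiLp.norm_single, Real.norm_eq_abs, sq_abs, abs_neg,
      Finset.sum_const, Finset.card_univ, Fintype.card_fin, nsmul_eq_mul]
    linear_combination 2 * (d : ℝ) * hexp
  rw [← hint, ← integral_indicator_one (measurableSet_lt_supNorm d r)]
  refine integral_mono ((integrable_const (1 : ℝ)).indicator (measurableSet_lt_supNorm d r)) hF
    fun z => Set.indicator_le' (fun z hz => ?_) (fun z _ => by positivity) z
  obtain ⟨i, hi⟩ : ∃ i, r < |z i| := by
    by_contra! h
    exact absurd ((pi_norm_le_iff_of_nonneg hr).2 h) (not_le.2 hz)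
  refine le_trans ?_ (Finset.single_le_sum (fun j _ => by positivity) (Finset.mem_univ i))
  simp only [e, EuclideanSpace.inner_single_right, Pi.one_apply, conj_trivial, mul_add,
    ← Real.exp_add]
  rcases lt_abs.1 hi with h | h
  · have : 1 ≤ rexp (-r ^ 2 + r * z i) := Real.one_le_exp (by nlinarith)
    linarith [Real.exp_pos (-r ^ 2 + -r * z i)]
  · have : 1 ≤ rexp (-r ^ 2 + -r * z i) := Real.one_le_exp (by nlinarith)
    linarith [Real.exp_pos (-r ^ 2 + r * z i)]

/-- For `Z ~ N(0, I_d)` and every `r ≥ 0`, the truncated second moment satisfies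
`E[‖Z‖² · 1{‖Z‖_∞ > r}] ≤ √(2d) √(d(d+2)) exp(−r²/4)`. -/
theorem gaussian_truncated_second_moment (d : ℕ) (hd : 1 ≤ d) (r : ℝ) (hr : 0 ≤ r) :
    (∫ z in {z : EuclideanSpace ℝ (Fin d) | r < supNorm z}, ‖z‖ ^ 2 ∂(stdGaussian d)) ≤
      Real.sqrt (2 * d) * Real.sqrt ((d : ℝ) * ((d : ℝ) + 2)) * Real.exp (-r ^ 2 / 4) := by
  set A := {z : EuclideanSpace ℝ (Fin d) | r < supNorm z}
  have hA : MeasurableSet A := measurableSet_lt_supNorm d r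
  have hfour := integral_norm_pow_four_stdGaussian d hd
  have hfi : Integrable (fun z => ‖z‖ ^ 4) (stdGaussian d) :=
    .of_integral_ne_zero (by rw [hfour]; positivity)
  have hmem : MemLp (fun z => ‖z‖ ^ 2) (ENNReal.ofReal 2) (stdGaussian d) := by
    rw [ENNReal.ofReal_ofNat, memLp_two_iff_integrable_sq (by fun_prop)]
    simpa only [← pow_mul] using hfi
  have hmemA : MemLp (A.indicator fun _ => (1 : ℝ)) (ENNReal.ofReal 2) (stdGaussian d) :=
    memLp_indicator_const _ hA _ (.inr (measure_ne_top _ _))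
  have hCS := integral_mul_le_Lp_mul_Lq_of_nonneg Real.HolderConjugate.two_two
    (.of_forall fun z => by positivity)
    (.of_forall fun z => Set.indicator_nonneg (fun _ _ => zero_le_one) z) hmem hmemA
  have hsq (z : EuclideanSpace ℝ (Fin d)) :
      A.indicator (fun _ => (1 : ℝ)) z ^ (2 : ℝ) = A.indicator 1 z := by
    by_cases hz : z ∈ A <;> simp [hz]
  have hmul (z : EuclideanSpace ℝ (Fin d)) :
      ‖z‖ ^ 2 * A.indicator (fun _ => (1 : ℝ)) z = A.indicator (fun z => ‖z‖ ^ 2) z := by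
    by_cases hz : z ∈ A <;> simp [hz]
  simp_rw [hsq, hmul, Real.rpow_two, ← pow_mul, ← Real.sqrt_eq_rpow] at hCS
  rw [integral_indicator hA, integral_indicator_one hA, hfour] at hCS
  refine hCS.trans ?_
  have htail : √((stdGaussian d).real A) ≤ √(2 * d) * rexp (-r ^ 2 / 4) := by
    refine Real.sqrt_le_iff.2 ⟨by positivity, ?_⟩
    rw [mul_pow, Real.sq_sqrt (by positivity), ← Real.exp_nat_mul]
    convert! measureReal_lt_supNorm_stdGaussian_le d hr using 3
    push_cast
    ring
  calc _ ≤ √((d : ℝ) * (d + 2)) * (√(2 * d) * rexp (-r ^ 2 / 4)) := by gcongr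
    _ = _ := by ring
end
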